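/- (Equicontinuity for positive times.) Let T > σ̄ > 0 and μ > 0, and let {f_ε}_{ε∈(0,1)} be a family of weak solutions of the ε-fusion coagulation problem with common initial datum and uniform moment bounds sup_{t∈[0,T]} ∫ (v^{−1} + v² + a + a^{μ+3} + v^{σ(μ+3)}) df_ε(t) ≤ C(T) independent of ε. Then for every φ ∈ C₀((0,∞)²) with ‖φ‖_∞ ≤ 1 and every ε̄ ∈ (0,1) there exists δ̄ ∈ (0, σ̄) such that |∫ φ(η) df_ε(t)(η) − ∫ φ(η) df_ε(s)(η)| ≤ ε̄ for all s, t ∈ [σ̄, T] with |t − s| ≤ δ̄ and all ε sufficiently small. -/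

import Mathlib

open MeasureTheory Real Set Filter Topology
open scoped ENNReal

noncomputable section

/-- `c₀ = (36π)^(1/3)`, the isoperimetric constant relating area and volume of a ball. -/
def c0 : ℝ := (36 * Real.pi) ^ ((1 : ℝ) / 3)

/-- The open quadrant `(0,∞)²` of pairs `(a,v)` (surface area, volume). -/
def Quad : Set (ℝ × ℝ) := {p | 0 < p.1 ∧ 0 < p.2}

/-- The isoperimetric region `{(a,v) : v > 0, a ≥ c₀ v^(2/3)}`. -/
def IsoRegion : Set (ℝ × ℝ) := {p | 0 < p.2 ∧ c0 * p.2 ^ ((2 : ℝ) / 3) ≤ p.1}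

/-- A nonnegative (Radon) measure on `(0,∞)²` supported in `{a ≥ c₀ v^(2/3)}`:
it gives zero mass to the complement of the isoperimetric region. -/
def IsIsoMeasure (m : Measure (ℝ × ℝ)) : Prop := m IsoRegionᶜ = 0

/-- `C₀((0,∞)²)`: continuous functions vanishing at infinity of the open quadrant
(extended by zero outside the quadrant). -/
def IsC0Quad (φ : ℝ × ℝ → ℝ) : Prop :=
  Continuous φ ∧ (∀ p, p ∉ Quad → φ p = 0) ∧
    ∀ δ > 0, ∃ Kc : Set (ℝ × ℝ), IsCompact Kc ∧ Kc ⊆ Quad ∧ ∀ p ∉ Kc, |φ p| ≤ δ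

/-- `C_c((0,∞)²)`: continuous functions with compact support contained in the quadrant. -/
def IsCcQuad (φ : ℝ × ℝ → ℝ) : Prop :=
  Continuous φ ∧ HasCompactSupport φ ∧ tsupport φ ⊆ Quad

/-- `C₀((0,∞))`: continuous functions on `(0,∞)` vanishing at infinity (extended by zero). -/
def IsC0Pos (φ : ℝ → ℝ) : Prop :=
  Continuous φ ∧ (∀ v, v ∉ Ioi (0 : ℝ) → φ v = 0) ∧
    ∀ δ > 0, ∃ Kc : Set ℝ, IsCompact Kc ∧ Kc ⊆ Ioi (0 : ℝ) ∧ ∀ v ∉ Kc, |φ v| ≤ δ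

/-- `C_c((0,∞))`: continuous functions with compact support contained in `(0,∞)`. -/
def IsCcPos (φ : ℝ → ℝ) : Prop :=
  Continuous φ ∧ HasCompactSupport φ ∧ tsupport φ ⊆ Ioi (0 : ℝ)

/-- Partial derivative in the area variable `a`. -/
def da (φ : ℝ × ℝ → ℝ) (p : ℝ × ℝ) : ℝ := deriv (fun a => φ (a, p.2)) p.1

/-- Time-dependent test functions `φ ∈ C¹_c([0,∞); C¹_c((0,∞)²))`. -/
def IsTestFun (ψ : ℝ × (ℝ × ℝ) → ℝ) : Prop :=
  ContDiff ℝ 1 ψ ∧ HasCompactSupport ψ ∧ ∀ q : ℝ × (ℝ × ℝ), q.2 ∉ Quad → ψ q = 0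

/-- The assumptions on the coagulation kernel `K`: continuity, symmetry, and the
two-sided power law bounds with constants `K₀ ≥ K₁ > 0` and exponents
`al > 0`, `be ∈ (0,1)`, `be - al ∈ (0,1)`. -/
structure IsCoagKernel (K : ℝ × ℝ → ℝ × ℝ → ℝ) (K₀ K₁ al be : ℝ) : Prop where
  cont : ContinuousOn (fun q : (ℝ × ℝ) × (ℝ × ℝ) => K q.1 q.2) (Quad ×ˢ Quad)
  symm : ∀ η η', K η η' = K η' η
  K1_pos : 0 < K₁
  K1_le_K0 : K₁ ≤ K₀
  al_pos : 0 < al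
  be_mem : be ∈ Ioo (0 : ℝ) 1
  be_sub_al_mem : be - al ∈ Ioo (0 : ℝ) 1
  lower : ∀ η ∈ Quad, ∀ η' ∈ Quad,
    K₁ * (η.2 ^ (-al) * η'.2 ^ be + η'.2 ^ (-al) * η.2 ^ be) ≤ K η η'
  upper : ∀ η ∈ Quad, ∀ η' ∈ Quad,
    K η η' ≤ K₀ * (η.2 ^ (-al) * η'.2 ^ be + η'.2 ^ (-al) * η.2 ^ be)

/-- The assumptions on an admissible fusion kernel `r`: positivity, `C¹` regularity,
two-sided power law bounds `R₀ a^mu v^sg ≤ r ≤ R₁ a^mu v^sg`, and the structural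
differential inequalities on the isoperimetric region. -/
structure IsFusionKernel (r : ℝ × ℝ → ℝ) (R₀ R₁ mu sg B : ℝ) : Prop where
  smooth : ContDiffOn ℝ 1 r Quad
  pos : ∀ η ∈ Quad, 0 < r η
  R0_pos : 0 < R₀
  R1_pos : 0 < R₁
  B_pos : 0 < B
  lower : ∀ η ∈ Quad, R₀ * η.1 ^ mu * η.2 ^ sg ≤ r η
  upper : ∀ η ∈ Quad, r η ≤ R₁ * η.1 ^ mu * η.2 ^ sg
  cond_pos : 0 < mu → ∀ η ∈ IsoRegion, 0 ≤ da r η - mu * η.1⁻¹ * r η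
  cond_nonpos : mu ≤ 0 → ∀ η ∈ IsoRegion,
    0 ≤ da r η * (η.1 - c0 * η.2 ^ ((2 : ℝ) / 3)) + r η
  cond_upper : ∀ η ∈ IsoRegion, da r η ≤ B * η.1⁻¹ * r η

/-- The weak identity at time `t` against the test function `ψ`, for the
fusion–coagulation equation with fusion coefficient `c` (the `Λ`-fusion problem
corresponds to `c = Λ⁻¹`). -/
def WeakIdentity (K : ℝ × ℝ → ℝ × ℝ → ℝ) (r : ℝ × ℝ → ℝ) (c : ℝ)
    (fin : Measure (ℝ × ℝ)) (f : ℝ → Measure (ℝ × ℝ))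
    (ψ : ℝ × (ℝ × ℝ) → ℝ) (t : ℝ) : Prop :=
  (∫ η, ψ (t, η) ∂(f t)) - (∫ η, ψ (0, η) ∂fin)
      - ∫ s in (0 : ℝ)..t, ∫ η, deriv (fun u => ψ (u, η)) s ∂(f s)
    = (∫ s in (0 : ℝ)..t, (1 / 2) *
        ∫ η, ∫ η', K η η' * (ψ (s, η + η') - ψ (s, η) - ψ (s, η')) ∂(f s) ∂(f s))
      + c * ∫ s in (0 : ℝ)..t,
          ∫ η, r η * (c0 * η.2 ^ ((2 : ℝ) / 3) - η.1) * da (fun p => ψ (s, p)) η ∂(f s)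

/-- A weak solution of the fusion–coagulation problem with fusion coefficient `c`
(power-law exponents `al`, `be` of the coagulation kernel enter the a priori moment
bound), initial datum `fin`: a weak-* continuous family of measures supported in the
isoperimetric region, with locally uniformly bounded `(v^(-al) + v^be)`-moments,
satisfying the weak identity for all test functions and times. -/
def IsWeakSolution (K : ℝ × ℝ → ℝ × ℝ → ℝ) (r : ℝ × ℝ → ℝ) (c al be : ℝ)
    (fin : Measure (ℝ × ℝ)) (f : ℝ → Measure (ℝ × ℝ)) : Prop :=
  (∀ t, 0 ≤ t → IsIsoMeasure (f t)) ∧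
  (∀ φ, IsC0Quad φ → ContinuousOn (fun t => ∫ η, φ η ∂(f t)) (Ici (0 : ℝ))) ∧
  (∀ T > (0 : ℝ), ∃ C : ℝ≥0∞, C ≠ ⊤ ∧ ∀ t ∈ Icc (0 : ℝ) T,
      (∫⁻ η, ENNReal.ofReal (η.2 ^ (-al) + η.2 ^ be) ∂(f t)) ≤ C) ∧
  (∀ ψ, IsTestFun ψ → ∀ t, 0 ≤ t → WeakIdentity K r c fin f ψ t)

/-- The regularized fusion kernel `r̄_ε(a,v) = r(a,v)/(1 + ε^(2μ+2) a^μ)`. -/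
def rbarFn (r : ℝ × ℝ → ℝ) (mu ε : ℝ) (η : ℝ × ℝ) : ℝ :=
  r η / (1 + ε ^ (2 * mu + 2) * η.1 ^ mu)

end

noncomputable section

/-- The integrand of the fusion term for a time-independent test function. -/
def fusionIntegrand (r φ : ℝ × ℝ → ℝ) (η : ℝ × ℝ) : ℝ :=
  r η * (c0 * η.2 ^ ((2 : ℝ) / 3) - η.1) * da φ η

/-- The coagulation term for a time-independent test function. -/
def coagTerm (K : ℝ × ℝ → ℝ × ℝ → ℝ) (ν : Measure (ℝ × ℝ)) (φ : ℝ × ℝ → ℝ) : ℝ :=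
  ∫ η, ∫ η', K η η' * (φ (η + η') - φ η - φ η') ∂ν ∂ν

end

/-- `ν` lives on the isoperimetric region and its `W`-moment is at most `C`. -/
structure HasMomentBound (W : ℝ × ℝ → ℝ) (C : ℝ) (ν : Measure (ℝ × ℝ)) : Prop where
  iso : ∀ᵐ η ∂ν, η ∈ IsoRegion
  integrable : Integrable W ν
  integral_le : ∫ η, W η ∂ν ≤ C

theorem c0_pos : 0 < c0 := by
  unfold c0; positivity

theorem isoRegion_subset_quad : IsoRegion ⊆ Quad := by
  rintro p ⟨h, h'⟩
  exact ⟨lt_of_lt_of_le (mul_pos c0_pos (rpow_pos_of_pos h _)) h', h⟩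

theorem add_mem_isoRegion {p q : ℝ × ℝ} (hp : p ∈ IsoRegion) (hq : q ∈ IsoRegion) :
    p + q ∈ IsoRegion := by
  obtain ⟨hp, hp'⟩ := hp
  obtain ⟨hq, hq'⟩ := hq
  refine ⟨add_pos hp hq, ?_⟩
  have h := Real.rpow_add_le_add_rpow hp.le hq.le (p := 2 / 3) (by norm_num) (by norm_num)
  have := mul_le_mul_of_nonneg_left h c0_pos.le
  simp only [Prod.snd_add, Prod.fst_add]
  linarith

theorem isOpen_quad : IsOpen Quad :=
  (isOpen_lt continuous_const continuous_fst).inter (isOpen_lt continuous_const continuous_snd)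

theorem rpow_le_rpow_neg_one_add_sq {v p : ℝ} (hv : 0 < v) (h1 : -1 ≤ p) (h2 : p ≤ 2) :
    v ^ p ≤ v ^ (-1 : ℝ) + v ^ (2 : ℝ) := by
  have := rpow_pos_of_pos hv (-1)
  have := rpow_pos_of_pos hv 2
  rcases le_total v 1 with h | h
  · have := rpow_le_rpow_of_exponent_ge hv h h1
    linarith
  · have := rpow_le_rpow_of_exponent_le h h2
    linarith

section Moments

variable {W : ℝ × ℝ → ℝ} {C : ℝ} {ν : Measure (ℝ × ℝ)}

theorem HasMomentBound.abs_integral_le (h : HasMomentBound W C ν) {g : ℝ × ℝ → ℝ} {k : ℝ}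
    (hk : 0 ≤ k) (hg : ∀ η ∈ IsoRegion, |g η| ≤ k * W η) : |∫ η, g η ∂ν| ≤ k * C := by
  have := norm_integral_le_of_norm_le (h.integrable.const_mul k)
    (f := g) (h.iso.mono hg)
  rw [integral_const_mul] at this
  exact this.trans (mul_le_mul_of_nonneg_left h.integral_le hk)

theorem HasMomentBound.integral_le_mul (h : HasMomentBound W C ν) {g : ℝ × ℝ → ℝ} {k : ℝ}
    (hk : 0 ≤ k) (hi : Integrable g ν) (hg : ∀ η ∈ IsoRegion, g η ≤ k * W η) :
    ∫ η, g η ∂ν ≤ k * C := by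
  have := integral_mono_ae hi (h.integrable.const_mul k) (h.iso.mono fun η hη => hg η hη)
  rw [integral_const_mul] at this
  exact this.trans (mul_le_mul_of_nonneg_left h.integral_le hk)

theorem HasMomentBound.nonneg (h : HasMomentBound W C ν) (hW : ∀ η ∈ IsoRegion, 1 ≤ W η) :
    0 ≤ C :=
  (integral_nonneg_of_ae (h.iso.mono fun η hη => zero_le_one.trans (hW η hη))).trans h.integral_le

theorem HasMomentBound.integrable_of_isC0Quad (h : HasMomentBound W C ν)
    (hW : ∀ η ∈ IsoRegion, 1 ≤ W η) {φ : ℝ × ℝ → ℝ} (hφ : IsC0Quad φ) : Integrable φ ν := by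
  obtain ⟨hc, -, hd⟩ := hφ
  obtain ⟨Kc, hKc, -, hsm⟩ := hd 1 one_pos
  obtain ⟨b, hb⟩ := hKc.exists_bound_of_continuousOn hc.continuousOn
  refine (h.integrable.const_mul (max b 1)).mono' hc.aestronglyMeasurable
    (h.iso.mono fun η hη => ?_)
  have hm : |φ η| ≤ max b 1 := by
    by_cases hK : η ∈ Kc
    · exact (hb η hK).trans (le_max_left _ _)
    · exact (hsm η hK).trans (le_max_right _ _)
  exact hm.trans (le_mul_of_one_le_right (le_trans zero_le_one (le_max_right _ _)) (hW η hη))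

/-- The coagulation term is bounded by the sup norm of the test function and the moments. -/
theorem HasMomentBound.abs_coagTerm_le (h : HasMomentBound W C ν)
    (hW1 : ∀ η ∈ IsoRegion, 1 ≤ W η)
    {K : ℝ × ℝ → ℝ × ℝ → ℝ} {K₀ K₁ al be : ℝ} (hK : IsCoagKernel K K₀ K₁ al be)
    (hWal : ∀ η ∈ IsoRegion, η.2 ^ (-al) ≤ W η) (hWbe : ∀ η ∈ IsoRegion, η.2 ^ be ≤ W η)
    {φ : ℝ × ℝ → ℝ} {b : ℝ} (hb : ∀ η ∈ IsoRegion, |φ η| ≤ b) (hb0 : 0 ≤ b) :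
    |coagTerm K ν φ| ≤ 6 * K₀ * b * C ^ 2 := by
  have hK0 : 0 ≤ K₀ := (hK.K1_pos.trans_le hK.K1_le_K0).le
  have hC := h.nonneg hW1
  have key : ∀ η ∈ IsoRegion, ∀ η' ∈ IsoRegion,
      |K η η' * (φ (η + η') - φ η - φ η')| ≤ (6 * K₀ * b * W η) * W η' := by
    intro η hη η' hη'
    have hq := isoRegion_subset_quad hη
    have hq' := isoRegion_subset_quad hη'
    have e1 := rpow_nonneg hq.2.le (-al)
    have e2 := rpow_nonneg hq.2.le be
    have e3 := rpow_nonneg hq'.2.le (-al)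
    have e4 := rpow_nonneg hq'.2.le be
    have hlow := hK.lower η hq η' hq'
    have hup := hK.upper η hq η' hq'
    have h0 : 0 ≤ K η η' := le_trans (mul_nonneg hK.K1_pos.le (by positivity)) hlow
    have w1 := hW1 η hη
    have w2 := hW1 η' hη'
    have m1 : η.2 ^ (-al) * η'.2 ^ be ≤ W η * W η' :=
      mul_le_mul (hWal η hη) (hWbe η' hη') e4 (by linarith)
    have m2 : η'.2 ^ (-al) * η.2 ^ be ≤ W η * W η' := by
      rw [mul_comm]; exact mul_le_mul (hWbe η hη) (hWal η' hη') e3 (by linarith)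
    have hKle : K η η' ≤ K₀ * (2 * (W η * W η')) :=
      hup.trans (mul_le_mul_of_nonneg_left (by linarith) hK0)
    have hφ : |φ (η + η') - φ η - φ η'| ≤ 3 * b := by
      have a1 := abs_le.1 (hb _ (add_mem_isoRegion hη hη'))
      have a2 := abs_le.1 (hb _ hη)
      have a3 := abs_le.1 (hb _ hη')
      rw [abs_le]; constructor <;> linarith
    rw [abs_mul, abs_of_nonneg h0]
    calc K η η' * |φ (η + η') - φ η - φ η'| ≤ (K₀ * (2 * (W η * W η'))) * (3 * b) :=
          mul_le_mul hKle hφ (abs_nonneg _) (h0.trans hKle)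
      _ = _ := by ring
  have hin : ∀ η ∈ IsoRegion,
      |∫ η', K η η' * (φ (η + η') - φ η - φ η') ∂ν| ≤ (6 * K₀ * b * C) * W η := by
    intro η hη
    have := hW1 η hη
    refine (h.abs_integral_le (k := 6 * K₀ * b * W η) (by positivity) (key η hη)).trans_eq ?_
    ring
  refine (h.abs_integral_le (k := 6 * K₀ * b * C) (by positivity) hin).trans_eq ?_
  ring

end Moments

theorem hasCompactSupport_of_eq_zero {φ : ℝ × ℝ → ℝ} {S : Set (ℝ × ℝ)} (hS : IsCompact S)
    (hQ : S ⊆ Quad) (hφ : Continuous φ) (h0 : ∀ p ∉ S, φ p = 0) : IsCcQuad φ := by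
  refine ⟨hφ, HasCompactSupport.intro hS h0, ?_⟩
  exact (closure_minimal (Function.support_subset_iff'.2 h0) hS.isClosed).trans hQ

theorem IsCcQuad.isC0Quad {φ : ℝ × ℝ → ℝ} (h : IsCcQuad φ) : IsC0Quad φ := by
  obtain ⟨hc, hs, ht⟩ := h
  refine ⟨hc, fun p hp => image_eq_zero_of_notMem_tsupport fun h => hp (ht h), fun δ hδ =>
    ⟨tsupport φ, hs, ht, fun p hp => ?_⟩⟩
  rw [image_eq_zero_of_notMem_tsupport hp, abs_zero]
  exact hδ.le

theorem da_eq_fderiv {φ : ℝ × ℝ → ℝ} {p : ℝ × ℝ} (h : DifferentiableAt ℝ φ p) :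
    da φ p = fderiv ℝ φ p (1, 0) := by
  have h1 : HasDerivAt (fun a : ℝ => (a, p.2)) ((1 : ℝ), (0 : ℝ)) p.1 :=
    (hasDerivAt_id p.1).prodMk (hasDerivAt_const p.1 p.2)
  have h2 : HasFDerivAt φ (fderiv ℝ φ p) ((fun a : ℝ => (a, p.2)) p.1) := h.hasFDerivAt
  exact (h2.comp_hasDerivAt p.1 h1).deriv

theorem continuous_da {φ : ℝ × ℝ → ℝ} (h : ContDiff ℝ 1 φ) : Continuous (da φ) := by
  have : da φ = fun p => fderiv ℝ φ p (1, 0) :=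
    funext fun p => da_eq_fderiv (h.differentiable one_ne_zero p)
  rw [this]
  exact (h.continuous_fderiv one_ne_zero).clm_apply continuous_const

theorem da_eq_zero_of_notMem_tsupport {φ : ℝ × ℝ → ℝ} (h : ContDiff ℝ 1 φ) {p : ℝ × ℝ}
    (hp : p ∉ tsupport φ) : da φ p = 0 := by
  rw [da_eq_fderiv (h.differentiable one_ne_zero p),
    image_eq_zero_of_notMem_tsupport fun h' => hp (tsupport_fderiv_subset ℝ h')]
  simp

theorem isCcQuad_fusionIntegrand {r φ : ℝ × ℝ → ℝ} (hr : ContinuousOn r Quad)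
    (h : ContDiff ℝ 1 φ) (hφ : IsCcQuad φ) : IsCcQuad (fusionIntegrand r φ) := by
  obtain ⟨-, hs, ht⟩ := hφ
  have h0 : ∀ p ∉ tsupport φ, fusionIntegrand r φ p = 0 := fun p hp => by
    simp [fusionIntegrand, da_eq_zero_of_notMem_tsupport h hp]
  refine hasCompactSupport_of_eq_zero hs ht ?_ h0
  rw [continuous_iff_continuousAt]
  intro p
  by_cases hp : p ∈ tsupport φ
  · have hq := ht hp
    have hr' := hr.continuousAt (isOpen_quad.mem_nhds hq)
    have hv : ContinuousAt (fun η : ℝ × ℝ => η.2 ^ ((2 : ℝ) / 3)) p :=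
      continuousAt_snd.rpow_const (Or.inl hq.2.ne')
    exact (hr'.mul ((continuousAt_const.mul hv).sub continuousAt_fst)).mul
      (continuous_da h).continuousAt
  · have : fusionIntegrand r φ =ᶠ[𝓝 p] fun _ => 0 :=
      Filter.eventually_of_mem ((isClosed_tsupport φ).isOpen_compl.mem_nhds hp) h0
    exact continuousAt_const.congr this.symm

/-- The weak identity for a product of a time weight and a spatial test function. -/
theorem weighted_weakIdentity {K : ℝ × ℝ → ℝ × ℝ → ℝ} {r : ℝ × ℝ → ℝ} {c : ℝ}
    {fin : Measure (ℝ × ℝ)} {f : ℝ → Measure (ℝ × ℝ)}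
    (hf : ∀ ψ, IsTestFun ψ → ∀ t, 0 ≤ t → WeakIdentity K r c fin f ψ t)
    {φ : ℝ × ℝ → ℝ} (h : ContDiff ℝ 1 φ) (hφ : IsCcQuad φ) {θ : ℝ → ℝ} (hθ : ContDiff ℝ 1 θ)
    {t : ℝ} (ht : 0 ≤ t) :
    θ t * (∫ η, φ η ∂(f t)) - θ 0 * (∫ η, φ η ∂fin)
        - ∫ s in (0 : ℝ)..t, deriv θ s * ∫ η, φ η ∂(f s)
      = (∫ s in (0 : ℝ)..t, (1 / 2) * (θ s * coagTerm K (f s) φ))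
        + c * ∫ s in (0 : ℝ)..t, θ s * ∫ η, fusionIntegrand r φ η ∂(f s) := by
  set cut : ℝ → ℝ := fun s => smoothTransition (s + 2) * smoothTransition (t + 2 - s) with hcut
  have hcutC : ContDiff ℝ 1 cut := by
    have := @smoothTransition.contDiff 1
    exact (this.comp (contDiff_id.add contDiff_const)).mul
      (this.comp (contDiff_const.sub contDiff_id))
  have hcut1 : ∀ s ∈ Icc (-1 : ℝ) (t + 1), cut s = 1 := fun s hs => by
    simp only [hcut]
    rw [smoothTransition.one_of_one_le (by linarith [hs.1]),
      smoothTransition.one_of_one_le (by linarith [hs.2]), one_mul]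
  have hcut0 : ∀ s ∉ Icc (-2 : ℝ) (t + 2), cut s = 0 := fun s hs => by
    simp only [hcut]
    by_cases h1 : -2 ≤ s
    · have h2 : t + 2 < s := not_le.1 fun h2 => hs ⟨h1, h2⟩
      rw [smoothTransition.zero_of_nonpos (x := t + 2 - s) (by linarith), mul_zero]
    · rw [smoothTransition.zero_of_nonpos (x := s + 2) (by linarith [not_le.1 h1]), zero_mul]
  set ψ : ℝ × (ℝ × ℝ) → ℝ := fun q => cut q.1 * θ q.1 * φ q.2 with hψ
  have hval : ∀ s ∈ Icc (-1 : ℝ) (t + 1), ∀ η, ψ (s, η) = θ s * φ η := fun s hs η => by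
    simp [hψ, hcut1 s hs]
  have htest : IsTestFun ψ := by
    refine ⟨?_, ?_, fun q hq => ?_⟩
    · exact ((hcutC.comp contDiff_fst).mul (hθ.comp contDiff_fst)).mul (h.comp contDiff_snd)
    · refine HasCompactSupport.intro ((isCompact_Icc (a := (-2 : ℝ)) (b := t + 2)).prod hφ.2.1)
        fun q hq => ?_
      simp only [hψ]
      by_cases h1 : q.1 ∈ Icc (-2 : ℝ) (t + 2)
      · rw [image_eq_zero_of_notMem_tsupport fun h2 => hq ⟨h1, h2⟩, mul_zero]
      · rw [hcut0 _ h1, zero_mul, zero_mul]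
    · simp only [hψ]
      rw [hφ.isC0Quad.2.1 _ hq, mul_zero]
  have hw := hf ψ htest t ht
  unfold WeakIdentity at hw
  have hmem : ∀ s ∈ uIcc (0 : ℝ) t, s ∈ Icc (-1 : ℝ) (t + 1) := fun s hs => by
    rw [uIcc_of_le ht] at hs
    exact ⟨by linarith [hs.1], by linarith [hs.2]⟩
  have e1 : ∀ s ∈ Icc (-1 : ℝ) (t + 1), ∀ ν : Measure (ℝ × ℝ),
      ∫ η, ψ (s, η) ∂ν = θ s * ∫ η, φ η ∂ν := fun s hs ν => by
    simp_rw [hval s hs, integral_const_mul]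
  have e2 : (∫ s in (0 : ℝ)..t, ∫ η, deriv (fun u => ψ (u, η)) s ∂(f s))
      = ∫ s in (0 : ℝ)..t, deriv θ s * ∫ η, φ η ∂(f s) := by
    refine intervalIntegral.integral_congr fun s hs => ?_
    rw [uIcc_of_le ht] at hs
    have hd : ∀ η, deriv (fun u => ψ (u, η)) s = deriv θ s * φ η := fun η => by
      have hnh : Icc (-1 : ℝ) (t + 1) ∈ 𝓝 s :=
        Icc_mem_nhds (by linarith [hs.1]) (by linarith [hs.2])
      have : (fun u => ψ (u, η)) =ᶠ[𝓝 s] fun u => θ u * φ η :=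
        Filter.eventually_of_mem hnh fun u hu => hval u hu η
      rw [this.deriv_eq]
      exact deriv_mul_const (hθ.differentiable one_ne_zero s) _
    simp_rw [hd, integral_const_mul]
  have e3 : (∫ s in (0 : ℝ)..t, (1 / 2) *
        ∫ η, ∫ η', K η η' * (ψ (s, η + η') - ψ (s, η) - ψ (s, η')) ∂(f s) ∂(f s))
      = ∫ s in (0 : ℝ)..t, (1 / 2) * (θ s * coagTerm K (f s) φ) := by
    refine intervalIntegral.integral_congr fun s hs => ?_
    have : ∀ η η', K η η' * (ψ (s, η + η') - ψ (s, η) - ψ (s, η'))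
        = θ s * (K η η' * (φ (η + η') - φ η - φ η')) := fun η η' => by
      simp only [hval s (hmem s hs)]; ring
    simp_rw [this, integral_const_mul, coagTerm]
  have e4 : (∫ s in (0 : ℝ)..t,
          ∫ η, r η * (c0 * η.2 ^ ((2 : ℝ) / 3) - η.1) * da (fun p => ψ (s, p)) η ∂(f s))
      = ∫ s in (0 : ℝ)..t, θ s * ∫ η, fusionIntegrand r φ η ∂(f s) := by
    refine intervalIntegral.integral_congr fun s hs => ?_
    have : ∀ η, r η * (c0 * η.2 ^ ((2 : ℝ) / 3) - η.1) * da (fun p => ψ (s, p)) η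
        = θ s * fusionIntegrand r φ η := fun η => by
      have hd : da (fun p => ψ (s, p)) η = θ s * da φ η := by
        unfold da
        simp_rw [hval s (hmem s hs)]
        have : DifferentiableAt ℝ (fun a => φ (a, η.2)) η.1 :=
          (h.comp (contDiff_id.prodMk contDiff_const)).differentiable one_ne_zero _
        exact deriv_const_mul _ this
      rw [hd, fusionIntegrand]; ring
    simp_rw [this, integral_const_mul]
  rw [e1 t (by constructor <;> linarith), e1 0 (by constructor <;> linarith), e2, e3, e4] at hw
  exact hw

theorem exists_abs_deriv_smoothTransition_le :
    ∃ U : ℝ, 0 ≤ U ∧ ∀ x, |deriv smoothTransition x| ≤ U := by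
  have hc : Continuous (deriv smoothTransition) :=
    (@smoothTransition.contDiff 1).continuous_deriv le_rfl
  obtain ⟨U, hU⟩ := (isCompact_Icc (a := (0 : ℝ)) (b := 1)).exists_bound_of_continuousOn
    hc.continuousOn
  have hU0 : 0 ≤ U := (norm_nonneg _).trans (hU 0 ⟨le_rfl, zero_le_one⟩)
  refine ⟨U, hU0, fun x => ?_⟩
  by_cases hx : x ∈ Icc (0 : ℝ) 1
  · exact hU x hx
  suffices deriv smoothTransition x = 0 by rw [this, abs_zero]; exact hU0
  rcases lt_or_ge x 0 with h | h
  · have : smoothTransition =ᶠ[𝓝 x] fun _ => 0 := Filter.eventually_of_mem (Iio_mem_nhds h)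
      fun y hy => smoothTransition.zero_of_nonpos (le_of_lt hy)
    rw [this.deriv_eq, deriv_const]
  · have h1 : 1 < x := not_le.1 fun h' => hx ⟨h, h'⟩
    have : smoothTransition =ᶠ[𝓝 x] fun _ => 1 := Filter.eventually_of_mem (Ioi_mem_nhds h1)
      fun y hy => smoothTransition.one_of_one_le (le_of_lt hy)
    rw [this.deriv_eq, deriv_const]

theorem exists_cutoff_Icc {v₀ v₁ : ℝ} (h0 : 0 < v₀) (h1 : 0 < v₁) :
    ∃ χ : ℝ → ℝ, ContDiff ℝ 1 χ ∧ (∀ v, 0 ≤ χ v) ∧ (∀ v, χ v ≤ 1) ∧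
      (∀ v ∈ Icc v₀ v₁, χ v = 1) ∧ ∀ v ∉ Icc (v₀ / 2) (2 * v₁), χ v = 0 := by
  have hs := @smoothTransition.contDiff 1
  refine ⟨fun v => smoothTransition ((v - v₀ / 2) / (v₀ / 2)) *
    smoothTransition ((2 * v₁ - v) / v₁), ?_, fun v => ?_, fun v => ?_, fun v hv => ?_,
    fun v hv => ?_⟩
  · exact (hs.comp ((contDiff_id.sub contDiff_const).div_const _)).mul
      (hs.comp ((contDiff_const.sub contDiff_id).div_const _))
  · exact mul_nonneg (smoothTransition.nonneg _) (smoothTransition.nonneg _)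
  · exact mul_le_one₀ (smoothTransition.le_one _) (smoothTransition.nonneg _)
      (smoothTransition.le_one _)
  · dsimp only
    rw [smoothTransition.one_of_one_le ((one_le_div (by linarith)).2 (by linarith [hv.1])),
      smoothTransition.one_of_one_le ((one_le_div h1).2 (by linarith [hv.2])), one_mul]
  · dsimp only
    by_cases h : v₀ / 2 ≤ v
    · have h' : 2 * v₁ < v := not_le.1 fun h' => hv ⟨h, h'⟩
      rw [smoothTransition.zero_of_nonpos (x := (2 * v₁ - v) / v₁)
        (div_nonpos_of_nonpos_of_nonneg (by linarith) h1.le), mul_zero]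
    · rw [smoothTransition.zero_of_nonpos
        (div_nonpos_of_nonpos_of_nonneg (by linarith [not_le.1 h]) (by linarith)), zero_mul]

/-- Bounded test functions comparable to the isoperimetric excess on a strip `v ∈ [v₀, v₁]`, which
are dissipated by the fusion term up to an error decaying in the truncation parameter `A`. -/
theorem exists_fusion_barrier {r : ℝ × ℝ → ℝ} {R₀ R₁ mu sg B : ℝ}
    (hr : IsFusionKernel r R₀ R₁ mu sg B) (hmu : 0 < mu) {v₀ v₁ : ℝ} (h0 : 0 < v₀)
    (h01 : v₀ ≤ v₁) :
    ∃ c k D : ℝ, 0 < c ∧ 0 < k ∧ 0 ≤ D ∧ ∀ A : ℝ, 1 ≤ A → ∃ Ψ : ℝ × ℝ → ℝ,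
      ContDiff ℝ 1 Ψ ∧ IsCcQuad Ψ ∧ (∀ η ∈ IsoRegion, 0 ≤ Ψ η ∧ Ψ η ≤ 1) ∧
      (∀ η ∈ IsoRegion, c * Ψ η + fusionIntegrand r Ψ η ≤ D / A ^ 2 * η.1 ^ (mu + 3)) ∧
      ∀ η ∈ IsoRegion, η.2 ∈ Icc v₀ v₁ → η.1 ≤ A →
        k * ((η.1 - c0 * η.2 ^ ((2 : ℝ) / 3)) / η.1) ≤ Ψ η := by
  have h1 : 0 < v₁ := h0.trans_le h01
  set b : ℝ → ℝ := fun v => c0 * v ^ ((2 : ℝ) / 3) with hb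
  have hbpos : ∀ v, 0 < v → 0 < b v := fun v hv => mul_pos c0_pos (rpow_pos_of_pos hv _)
  set ν : ℝ := min mu 1 with hν
  have hν0 : 0 < ν := lt_min hmu one_pos
  have hν1 : ν ≤ 1 := min_le_right _ _
  have hνmu : ν ≤ mu := min_le_left _ _
  obtain ⟨χ, hχc, hχ0, hχ1, hχone, hχzero⟩ := exists_cutoff_Icc h0 h1
  obtain ⟨U, hU0, hU⟩ := exists_abs_deriv_smoothTransition_le
  have hposI : ∀ v ∈ Icc (v₀ / 2) (2 * v₁), 0 < v := fun v hv => by linarith [hv.1]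
  have cb : ContinuousOn b (Icc (v₀ / 2) (2 * v₁)) := continuousOn_const.mul
    (continuousOn_id.rpow_const fun v hv => Or.inl (hposI v hv).ne')
  have csg : ContinuousOn (fun v : ℝ => v ^ sg) (Icc (v₀ / 2) (2 * v₁)) :=
    continuousOn_id.rpow_const fun v hv => Or.inl (hposI v hv).ne'
  obtain ⟨S, hS⟩ := isCompact_Icc.exists_bound_of_continuousOn csg
  have hS0 : 0 ≤ S := (norm_nonneg _).trans (hS v₁ ⟨by linarith, by linarith⟩)
  obtain ⟨vm, hvm, hmin⟩ := isCompact_Icc.exists_isMinOn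
    (nonempty_Icc.2 (by linarith : v₀ / 2 ≤ 2 * v₁))
    (csg.mul (cb.rpow_const fun v hv => Or.inl (hbpos v (hposI v hv)).ne') :
      ContinuousOn (fun v => v ^ sg * b v ^ mu) _)
  set m : ℝ := vm ^ sg * b vm ^ mu with hm
  have hm0 : 0 < m := mul_pos (rpow_pos_of_pos (hposI vm hvm) _)
    (rpow_pos_of_pos (hbpos _ (hposI vm hvm)) _)
  have hmle : ∀ v ∈ Icc (v₀ / 2) (2 * v₁), m ≤ v ^ sg * b v ^ mu := fun v hv => hmin hv
  set a₀ : ℝ := b (v₀ / 2) with ha₀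
  have ha₀pos : 0 < a₀ := hbpos _ (by linarith)
  have hR0 := hr.R0_pos
  have hR1 := hr.R1_pos
  refine ⟨R₀ * ν * m, ν, R₁ * S * U, by positivity, hν0, by positivity, fun A hA => ?_⟩
  set l : ℝ → ℝ := fun a => smoothTransition (4 * a / a₀ - 1) with hl
  set u : ℝ → ℝ := fun a => smoothTransition (A + 1 - a) with hu
  set p : ℝ × ℝ → ℝ := fun η => 1 - b η.2 ^ ν * η.1 ^ (-ν) with hp
  have hsm := @smoothTransition.contDiff 1
  have hlc : ContDiff ℝ 1 l :=
    hsm.comp (((contDiff_const.mul contDiff_id).div_const _).sub contDiff_const)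
  have huc : ContDiff ℝ 1 u := hsm.comp (contDiff_const.sub contDiff_id)
  have hl1 : ∀ a, a₀ / 2 ≤ a → l a = 1 := fun a ha =>
    smoothTransition.one_of_one_le (by rw [le_sub_iff_add_le, le_div_iff₀ ha₀pos]; linarith)
  have hl0 : ∀ a, a ≤ a₀ / 4 → l a = 0 := fun a ha =>
    smoothTransition.zero_of_nonpos (by rw [sub_nonpos, div_le_iff₀ ha₀pos]; linarith)
  have hu1 : ∀ a, a ≤ A → u a = 1 := fun a ha => smoothTransition.one_of_one_le (by linarith)
  have hu0 : ∀ a, A + 1 ≤ a → u a = 0 := fun a ha => smoothTransition.zero_of_nonpos (by linarith)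
  set Ψ : ℝ × ℝ → ℝ := fun η => χ η.2 * l η.1 * u η.1 * p η with hΨ
  have hzero : ∀ η ∉ Icc (a₀ / 4) (A + 1) ×ˢ Icc (v₀ / 2) (2 * v₁), Ψ η = 0 := by
    intro η hη
    simp only [hΨ]
    by_cases hv : η.2 ∈ Icc (v₀ / 2) (2 * v₁)
    · rcases le_or_gt η.1 (a₀ / 4) with ha | ha
      · rw [hl0 _ ha]; ring
      · rw [hu0 _ (le_of_not_ge fun ha' => hη ⟨⟨ha.le, ha'⟩, hv⟩)]; ring
    · rw [hχzero _ hv]; ring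
  have hΨc : ContDiff ℝ 1 Ψ := by
    rw [contDiff_iff_contDiffAt]
    intro η
    by_cases hη : η ∈ Quad
    · have d1 : ContDiffAt ℝ 1 (fun η : ℝ × ℝ => η.2 ^ ((2 : ℝ) / 3)) η :=
        contDiffAt_snd.rpow_const_of_ne hη.2.ne'
      have d2 : ContDiffAt ℝ 1 (fun η : ℝ × ℝ => b η.2 ^ ν) η :=
        (contDiffAt_const.mul d1).rpow_const_of_ne (hbpos _ hη.2).ne'
      have d3 : ContDiffAt ℝ 1 (fun η : ℝ × ℝ => η.1 ^ (-ν)) η :=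
        contDiffAt_fst.rpow_const_of_ne hη.1.ne'
      exact (((hχc.comp contDiff_snd).mul (hlc.comp contDiff_fst)).mul
        (huc.comp contDiff_fst)).contDiffAt.mul (contDiffAt_const.sub (d2.mul d3))
    · have hnm : η ∉ Icc (a₀ / 4) (A + 1) ×ˢ Icc (v₀ / 2) (2 * v₁) := fun h =>
        hη ⟨by linarith [h.1.1], by linarith [h.2.1]⟩
      have : Ψ =ᶠ[𝓝 η] fun _ => 0 := Filter.eventually_of_mem
        ((isClosed_Icc.prod isClosed_Icc).isOpen_compl.mem_nhds hnm) hzero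
      exact contDiffAt_const.congr_of_eventuallyEq this
  have hΨs : IsCcQuad Ψ := hasCompactSupport_of_eq_zero (isCompact_Icc.prod isCompact_Icc)
    (fun η hη => ⟨by linarith [hη.1.1], by linarith [hη.2.1]⟩) hΨc.continuous hzero
  have hpx : ∀ η ∈ IsoRegion, p η = 1 - (b η.2 / η.1) ^ ν := fun η hη => by
    have hq := isoRegion_subset_quad hη
    simp only [hp]
    rw [Real.div_rpow (hbpos _ hq.2).le hq.1.le, rpow_neg hq.1.le, div_eq_mul_inv]
  have hx : ∀ η ∈ IsoRegion, 0 < b η.2 / η.1 ∧ b η.2 / η.1 ≤ 1 := fun η hη => by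
    have hq := isoRegion_subset_quad hη
    exact ⟨div_pos (hbpos _ hq.2) hq.1, (div_le_one hq.1).2 hη.2⟩
  have hexc : ∀ η ∈ IsoRegion, (η.1 - b η.2) / η.1 = 1 - b η.2 / η.1 := fun η hη => by
    rw [sub_div, div_self (isoRegion_subset_quad hη).1.ne']
  have hp0 : ∀ η ∈ IsoRegion, 0 ≤ p η := fun η hη => by
    rw [hpx η hη, sub_nonneg]
    exact rpow_le_one (hx η hη).1.le (hx η hη).2 hν0.le
  have hp1 : ∀ η ∈ IsoRegion, p η ≤ 1 := fun η hη => by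
    rw [hpx η hη]
    linarith [rpow_nonneg (hx η hη).1.le ν]
  have hple : ∀ η ∈ IsoRegion, p η ≤ (η.1 - b η.2) / η.1 := fun η hη => by
    rw [hpx η hη, hexc η hη]
    have := rpow_le_rpow_of_exponent_ge (hx η hη).1 (hx η hη).2 hν1
    rw [rpow_one] at this
    linarith
  have hpge : ∀ η ∈ IsoRegion, ν * ((η.1 - b η.2) / η.1) ≤ p η := fun η hη => by
    rw [hpx η hη, hexc η hη]
    have := rpow_one_add_le_one_add_mul_self (s := b η.2 / η.1 - 1)
      (by linarith [(hx η hη).1]) hν0.le hν1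
    rw [add_sub_cancel] at this
    linarith
  have hlow : ∀ η ∈ IsoRegion, η.2 ∈ Icc (v₀ / 2) (2 * v₁) → a₀ ≤ η.1 := fun η hη hv =>
    le_trans (mul_le_mul_of_nonneg_left (rpow_le_rpow (by linarith) hv.1 (by norm_num))
      c0_pos.le) hη.2
  refine ⟨Ψ, hΨc, hΨs, fun η hη => ?_, fun η hη => ?_, fun η hη hv ha => ?_⟩
  · have n1 := smoothTransition.nonneg (4 * η.1 / a₀ - 1)
    have n2 := smoothTransition.nonneg (A + 1 - η.1)
    have hnn : 0 ≤ χ η.2 * l η.1 * u η.1 := mul_nonneg (mul_nonneg (hχ0 _) n1) n2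
    refine ⟨mul_nonneg hnn (hp0 η hη), mul_le_one₀ ?_ (hp0 η hη) (hp1 η hη)⟩
    exact mul_le_one₀ (mul_le_one₀ (hχ1 _) n1 (smoothTransition.le_one _)) n2
      (smoothTransition.le_one _)
  · have hq := isoRegion_subset_quad hη
    by_cases hv : η.2 ∈ Icc (v₀ / 2) (2 * v₁)
    swap
    · have e1 : ∀ a, Ψ (a, η.2) = 0 := fun a => by simp [hΨ, hχzero _ hv]
      have e2 : da Ψ η = 0 := by simp [da, e1]
      have e3 : Ψ η = 0 := e1 η.1
      rw [fusionIntegrand, e2, e3]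
      have := rpow_nonneg hq.1.le (mu + 3)
      simp only [mul_zero, add_zero]
      positivity
    have ha := hlow η hη hv
    have hpd : HasDerivAt (fun a => p (a, η.2)) (ν * b η.2 ^ ν * η.1 ^ (-ν - 1)) η.1 := by
      have := ((Real.hasDerivAt_rpow_const (p := -ν) (Or.inl hq.1.ne')).const_mul
        (b η.2 ^ ν)).const_sub 1
      convert! this using 1
      ring
    have hud : HasDerivAt u (-deriv smoothTransition (A + 1 - η.1)) η.1 := by
      have h1 := (hsm.differentiable one_ne_zero (A + 1 - η.1)).hasDerivAt
      have := h1.comp η.1 ((hasDerivAt_id η.1).const_sub (A + 1))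
      simpa using! this
    set u' : ℝ := -deriv smoothTransition (A + 1 - η.1) with hu'
    set p' : ℝ := ν * b η.2 ^ ν * η.1 ^ (-ν - 1) with hp'
    have hda : da Ψ η = χ η.2 * (u' * p η + u η.1 * p') := by
      have hev : (fun a => Ψ (a, η.2)) =ᶠ[𝓝 η.1] fun a => χ η.2 * (u a * p (a, η.2)) := by
        refine Filter.eventually_of_mem (Ioi_mem_nhds (by linarith : a₀ / 2 < η.1))
          fun a ha => ?_
        simp only [hΨ]
        rw [hl1 a (le_of_lt ha)]
        ring
      unfold da
      rw [hev.deriv_eq]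
      exact ((hud.mul hpd).const_mul _).deriv
    have hΨv : Ψ η = χ η.2 * (u η.1 * p η) := by
      simp only [hΨ]; rw [hl1 _ (by linarith)]; ring
    have hg : 0 ≤ η.1 - b η.2 := sub_nonneg.2 hη.2
    have hvpos := rpow_pos_of_pos hq.2 sg
    have hun : 0 ≤ u η.1 := smoothTransition.nonneg _
    have hrp := (hr.pos η hq).le
    have hdis : R₀ * ν * m * p η ≤ r η * (η.1 - b η.2) * p' := by
      have s1 : b η.2 ^ (mu - ν) ≤ η.1 ^ (mu - ν) :=
        rpow_le_rpow (hbpos _ hq.2).le hη.2 (by linarith)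
      have s2 : b η.2 ^ mu = b η.2 ^ (mu - ν) * b η.2 ^ ν := by
        rw [← rpow_add (hbpos _ hq.2)]; congr 1; ring
      have s3 : η.1 ^ mu * η.1 ^ (-ν - 1) = η.1 ^ (mu - ν) * η.1⁻¹ := by
        rw [← rpow_neg_one, ← rpow_add hq.1, ← rpow_add hq.1]; congr 1; ring
      have hbn := rpow_pos_of_pos (hbpos _ hq.2) ν
      have hp'n : 0 ≤ p' := by
        have := rpow_pos_of_pos hq.1 (-ν - 1)
        positivity
      have hinv := inv_pos.2 hq.1
      calc R₀ * ν * m * p η ≤ R₀ * ν * (η.2 ^ sg * b η.2 ^ mu) * ((η.1 - b η.2) / η.1) := by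
            have := hmle _ hv
            have := hple η hη
            have := hp0 η hη
            have := rpow_pos_of_pos (hbpos _ hq.2) mu
            gcongr
        _ = R₀ * ν * η.2 ^ sg * b η.2 ^ ν * ((η.1 - b η.2) * η.1⁻¹) * b η.2 ^ (mu - ν) := by
            rw [s2]; ring
        _ ≤ R₀ * ν * η.2 ^ sg * b η.2 ^ ν * ((η.1 - b η.2) * η.1⁻¹) * η.1 ^ (mu - ν) := by
            gcongr
        _ = (R₀ * η.1 ^ mu * η.2 ^ sg) * (η.1 - b η.2) * p' := by
            rw [hp']
            linear_combination (-(R₀ * ν * η.2 ^ sg * b η.2 ^ ν * (η.1 - b η.2))) * s3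
        _ ≤ r η * (η.1 - b η.2) * p' := by
            have := hr.lower η hq
            gcongr
    have herr : -(r η * (η.1 - b η.2) * (χ η.2 * (u' * p η)))
        ≤ R₁ * S * U / A ^ 2 * η.1 ^ (mu + 3) := by
      have hpw := rpow_nonneg hq.1.le (mu + 3)
      rcases lt_or_ge η.1 A with hlt | hge
      · have : u' = 0 := by
          have hev : u =ᶠ[𝓝 η.1] fun _ => 1 := Filter.eventually_of_mem (Iio_mem_nhds hlt)
            fun a ha => hu1 a (le_of_lt ha)
          rw [← hud.deriv, hev.deriv_eq, deriv_const]
        rw [this]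
        simp only [zero_mul, mul_zero, neg_zero]
        positivity
      · have hu'U : |u'| ≤ U := by rw [hu', abs_neg]; exact hU _
        have t1 : |χ η.2 * (u' * p η)| ≤ U := by
          rw [abs_mul, abs_mul, abs_of_nonneg (hχ0 _), abs_of_nonneg (hp0 η hη)]
          calc χ η.2 * (|u'| * p η) ≤ 1 * (|u'| * 1) := by
                have := hχ1 η.2
                have := hp1 η hη
                have := hp0 η hη
                have := hχ0 η.2
                gcongr
            _ ≤ U := by simpa using hu'U
        have t2 : r η ≤ R₁ * η.1 ^ mu * S := by
          refine (hr.upper η hq).trans ?_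
          have := (le_abs_self _).trans (hS _ hv)
          have := rpow_nonneg hq.1.le mu
          gcongr
        have t3 : η.1 - b η.2 ≤ η.1 := by linarith [hbpos _ hq.2]
        have t4 : η.1 ^ (mu + 3) = η.1 ^ mu * η.1 ^ 3 := by
          rw [rpow_add hq.1]; norm_cast
        have hA2 : (0 : ℝ) < A ^ 2 := by positivity
        calc -(r η * (η.1 - b η.2) * (χ η.2 * (u' * p η)))
            ≤ |r η * (η.1 - b η.2) * (χ η.2 * (u' * p η))| := neg_le_abs _
          _ = r η * (η.1 - b η.2) * |χ η.2 * (u' * p η)| := by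
              rw [abs_mul, abs_of_nonneg (mul_nonneg hrp hg)]
          _ ≤ (R₁ * η.1 ^ mu * S) * η.1 * U := by
              have := rpow_nonneg hq.1.le mu
              have := hq.1
              gcongr
          _ = R₁ * S * U * (η.1 ^ mu * η.1) := by ring
          _ ≤ R₁ * S * U * (η.1 ^ mu * η.1 ^ 3 / A ^ 2) := by
              have := rpow_nonneg hq.1.le mu
              have hle : A ^ 2 ≤ η.1 ^ 2 := by gcongr
              have : η.1 ^ mu * η.1 ≤ η.1 ^ mu * η.1 ^ 3 / A ^ 2 := by
                rw [le_div_iff₀ hA2]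
                calc η.1 ^ mu * η.1 * A ^ 2 ≤ η.1 ^ mu * η.1 * η.1 ^ 2 := by
                      have := hq.1
                      gcongr
                  _ = _ := by ring
              gcongr
          _ = _ := by rw [t4]; ring
    have hfus : fusionIntegrand r Ψ η = -(r η * (η.1 - b η.2) * (χ η.2 * (u' * p η)))
        - χ η.2 * u η.1 * (r η * (η.1 - b η.2) * p') := by
      rw [fusionIntegrand, hda]
      simp only [hb]
      ring
    have hmul := mul_le_mul_of_nonneg_left hdis (mul_nonneg (hχ0 η.2) hun)
    rw [hfus, hΨv]
    linarith
  · have hv' : η.2 ∈ Icc (v₀ / 2) (2 * v₁) := ⟨by linarith [hv.1], by linarith [hv.2]⟩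
    have hlo := hlow η hη hv'
    have : Ψ η = p η := by
      simp only [hΨ]
      rw [hχone _ hv, hl1 _ (by linarith), hu1 _ ha]
      ring
    rw [this]
    exact hpge η hη

theorem abs_intervalIntegral_le {g h : ℝ → ℝ} {a b : ℝ} (hab : a ≤ b)
    (hh : IntervalIntegrable h volume a b) (hgh : ∀ u ∈ Ioc a b, |g u| ≤ h u) :
    |∫ u in a..b, g u| ≤ ∫ u in a..b, h u :=
  (norm_eq_abs _).symm.trans_le
    (intervalIntegral.norm_integral_le_of_norm_le hab (Eventually.of_forall hgh) hh)

section Dynamics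

variable {K : ℝ × ℝ → ℝ × ℝ → ℝ} {r : ℝ × ℝ → ℝ} {c : ℝ} {fin : Measure (ℝ × ℝ)}
  {f : ℝ → Measure (ℝ × ℝ)}

theorem integral_initial_eq (hf : ∀ ψ, IsTestFun ψ → ∀ t, 0 ≤ t → WeakIdentity K r c fin f ψ t)
    {φ : ℝ × ℝ → ℝ} (h : ContDiff ℝ 1 φ) (hφ : IsCcQuad φ) :
    ∫ η, φ η ∂fin = ∫ η, φ η ∂(f 0) := by
  have := weighted_weakIdentity hf h hφ (contDiff_const (c := (1 : ℝ))) le_rfl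
  simp only [intervalIntegral.integral_same] at this
  linarith

/-- Exponential relaxation of an observable dissipated by the fusion term at rate `lam`, up to an
error controlled by the moments. -/
theorem integral_le_of_dissipation
    (hf : ∀ ψ, IsTestFun ψ → ∀ t, 0 ≤ t → WeakIdentity K r c fin f ψ t)
    (hcont : ∀ φ, IsC0Quad φ → ContinuousOn (fun t => ∫ η, φ η ∂(f t)) (Ici (0 : ℝ)))
    (hr : ContinuousOn r Quad) {W : ℝ × ℝ → ℝ} {C T : ℝ} (hW : ∀ η ∈ IsoRegion, 1 ≤ W η)
    (hmom : ∀ t ∈ Icc (0 : ℝ) T, HasMomentBound W C (f t))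
    {φ : ℝ × ℝ → ℝ} (h : ContDiff ℝ 1 φ) (hφ : IsCcQuad φ) (hφ1 : ∀ η ∈ IsoRegion, |φ η| ≤ 1)
    {Q : ℝ} (hQ : ∀ t ∈ Icc (0 : ℝ) T, |coagTerm K (f t) φ| ≤ Q)
    {lam D : ℝ} (hlam : 0 < lam) (hD : 0 ≤ D)
    (hdiss : ∀ η ∈ IsoRegion, lam * φ η + c * fusionIntegrand r φ η ≤ D * W η)
    {t : ℝ} (ht : 0 < t) (htT : t ≤ T) :
    ∫ η, φ η ∂(f t) ≤ (C / t + D * C + Q) / lam := by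
  have hT : (0 : ℝ) ≤ T := ht.le.trans htT
  have hfus := isCcQuad_fusionIntegrand hr h hφ
  set G : ℝ → ℝ := fun s => ∫ η, φ η ∂(f s) with hG
  set F : ℝ → ℝ := fun s => ∫ η, fusionIntegrand r φ η ∂(f s) with hF
  have hC : 0 ≤ C := (hmom 0 ⟨le_rfl, hT⟩).nonneg hW
  have hQ0 : 0 ≤ Q := (abs_nonneg _).trans (hQ 0 ⟨le_rfl, hT⟩)
  have hGF : ∀ s ∈ Icc (0 : ℝ) T, lam * G s + c * F s ≤ D * C := fun s hs => by
    have i1 := (hmom s hs).integrable_of_isC0Quad hW hφ.isC0Quad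
    have i2 := (hmom s hs).integrable_of_isC0Quad hW hfus.isC0Quad
    have := (hmom s hs).integral_le_mul hD ((i1.const_mul lam).add (i2.const_mul c)) hdiss
    rw [integral_add' (i1.const_mul lam) (i2.const_mul c)] at this
    simpa [hG, hF, integral_const_mul] using this
  have hsub : uIcc (0 : ℝ) t ⊆ Ici 0 := fun s hs => by
    rw [uIcc_of_le ht.le] at hs; exact hs.1
  have cG : ContinuousOn G (uIcc 0 t) := (hcont φ hφ.isC0Quad).mono hsub
  have cF : ContinuousOn F (uIcc 0 t) := (hcont _ hfus.isC0Quad).mono hsub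
  set θ : ℝ → ℝ := fun s => exp (lam * s) with hθ
  have hθc : ContDiff ℝ 1 θ := contDiff_exp.comp (contDiff_const.mul contDiff_id)
  have hθ' : ∀ s, HasDerivAt θ (lam * θ s) s := fun s => by
    have := ((hasDerivAt_id s).const_mul lam).exp
    simpa [hθ, mul_comm] using this
  have key := weighted_weakIdentity hf h hφ hθc ht.le
  rw [integral_initial_eq hf h hφ] at key
  simp_rw [fun s => (hθ' s).deriv] at key
  have hint : (∫ s in (0 : ℝ)..t, lam * θ s) = θ t - θ 0 :=
    intervalIntegral.integral_eq_sub_of_hasDerivAt (fun s _ => hθ' s)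
      ((continuous_const.mul hθc.continuous).intervalIntegrable _ _)
  have hint' : (∫ s in (0 : ℝ)..t, θ s) = (θ t - θ 0) / lam := by
    rw [intervalIntegral.integral_const_mul] at hint
    field_simp
    linarith
  have hθ0 : θ 0 = 1 := by simp [hθ]
  have b1 : (∫ s in (0 : ℝ)..t, lam * θ s * G s) + c * (∫ s in (0 : ℝ)..t, θ s * F s)
      ≤ D * C * ((θ t - θ 0) / lam) := by
    have j1 : IntervalIntegrable (fun s => lam * θ s * G s) volume 0 t :=
      ((continuous_const.mul hθc.continuous).continuousOn.mul cG).intervalIntegrable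
    have j2 : IntervalIntegrable (fun s => c * (θ s * F s)) volume 0 t :=
      (continuousOn_const.mul (hθc.continuous.continuousOn.mul cF)).intervalIntegrable
    rw [← intervalIntegral.integral_const_mul, ← intervalIntegral.integral_add j1 j2, ← hint',
      ← intervalIntegral.integral_const_mul]
    refine intervalIntegral.integral_mono_on ht.le (j1.add j2)
      ((continuous_const.mul hθc.continuous).intervalIntegrable _ _) fun s hs => ?_
    have := mul_le_mul_of_nonneg_left (hGF s ⟨hs.1, hs.2.trans htT⟩) (exp_pos (lam * s)).le
    simp only [hθ]
    linarith
  have b2 : (∫ s in (0 : ℝ)..t, (1 / 2) * (θ s * coagTerm K (f s) φ))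
      ≤ Q * ((θ t - θ 0) / lam) := by
    have j : IntervalIntegrable (fun s => Q * θ s) volume 0 t :=
      (continuous_const.mul hθc.continuous).intervalIntegrable _ _
    rw [← hint', ← intervalIntegral.integral_const_mul]
    refine (le_abs_self _).trans (abs_intervalIntegral_le ht.le j fun s hs => ?_)
    have hp : 0 < θ s := exp_pos _
    have := mul_le_mul_of_nonneg_left (hQ s ⟨hs.1.le, hs.2.trans htT⟩) hp.le
    rw [abs_mul, abs_mul, abs_of_pos hp, abs_of_pos (by norm_num : (0 : ℝ) < 1 / 2)]
    nlinarith [abs_nonneg (coagTerm K (f s) φ)]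
  have b3 : (∫ η, φ η ∂(f 0)) ≤ C := by
    have := (hmom 0 ⟨le_rfl, hT⟩).abs_integral_le (k := 1) zero_le_one
      (fun η hη => by rw [one_mul]; exact (hφ1 η hη).trans (hW η hη))
    rw [one_mul] at this
    exact (le_abs_self _).trans this
  have hθt : lam * t ≤ θ t := by
    have := add_one_le_exp (lam * t)
    simp only [hθ]; linarith
  have hpos : 0 < θ t := exp_pos _
  have hCt : C ≤ θ t * (C / t / lam) := by
    have := mul_le_mul_of_nonneg_right hθt (by positivity : 0 ≤ C / t / lam)
    calc C = lam * t * (C / t / lam) := by field_simp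
      _ ≤ _ := this
  have hfin : θ t * G t ≤ θ t * ((C / t + D * C + Q) / lam) := by
    have e : D * C * ((θ t - θ 0) / lam) + Q * ((θ t - θ 0) / lam)
        ≤ θ t * ((D * C + Q) / lam) := by
      rw [hθ0]
      have : 0 ≤ (D * C + Q) / lam := by positivity
      calc _ = θ t * ((D * C + Q) / lam) - (D * C + Q) / lam := by ring
        _ ≤ _ := by linarith
    have e2 : θ t * ((C / t + D * C + Q) / lam)
        = θ t * (C / t / lam) + θ t * ((D * C + Q) / lam) := by ring
    rw [hθ0, one_mul] at key
    rw [e2]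
    linarith
  exact le_of_mul_le_mul_left hfin hpos

/-- Lipschitz continuity in time of an observable, on an interval where its coagulation and fusion
rates of change are bounded. -/
theorem abs_integral_sub_le
    (hf : ∀ ψ, IsTestFun ψ → ∀ t, 0 ≤ t → WeakIdentity K r c fin f ψ t)
    {φ : ℝ × ℝ → ℝ} (h : ContDiff ℝ 1 φ) (hφ : IsCcQuad φ)
    (hcont : ContinuousOn (fun t => ∫ η, φ η ∂(f t)) (Ici (0 : ℝ)))
    {Q P s t : ℝ} (hs : 0 < s) (hst : s < t)
    (hQ : ∀ u ∈ Icc s t, |coagTerm K (f u) φ| ≤ Q)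
    (hP : ∀ u ∈ Icc s t, |c * ∫ η, fusionIntegrand r φ η ∂(f u)| ≤ P) :
    |(∫ η, φ η ∂(f t)) - ∫ η, φ η ∂(f s)| ≤ (Q + P) * (t - s) := by
  set F : ℝ → ℝ := fun s => ∫ η, φ η ∂(f s) with hF
  have hQ0 : 0 ≤ Q := (abs_nonneg _).trans (hQ s ⟨le_rfl, hst.le⟩)
  have hP0 : 0 ≤ P := (abs_nonneg _).trans (hP s ⟨le_rfl, hst.le⟩)
  refine le_of_forall_pos_le_add fun κ hκ => ?_
  obtain ⟨h₀, hh₀, hclose⟩ :=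
    Metric.continuousWithinAt_iff.1 (hcont s (mem_Ici.2 hs.le)) κ hκ
  obtain ⟨w, hw, hw'⟩ := exists_between (lt_min hh₀ (sub_pos.2 hst))
  have hw1 := hw'.trans_le (min_le_left _ _)
  have hw2 := hw'.trans_le (min_le_right _ _)
  set θ : ℝ → ℝ := fun u => smoothTransition ((u - s) / w) with hθ
  have hθc : ContDiff ℝ 1 θ :=
    (@smoothTransition.contDiff 1).comp ((contDiff_id.sub contDiff_const).div_const w)
  have hθ0 : ∀ u ≤ s, θ u = 0 := fun u hu =>
    smoothTransition.zero_of_nonpos (div_nonpos_of_nonpos_of_nonneg (by linarith) hw.le)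
  have hθ1 : ∀ u, s + w ≤ u → θ u = 1 := fun u hu =>
    smoothTransition.one_of_one_le ((one_le_div hw).2 (by linarith))
  have hmono : Monotone θ := fun a b hab =>
    smoothTransition.monotone (by gcongr)
  have hd0 : ∀ u, 0 ≤ deriv θ u := fun u => hmono.deriv_nonneg
  have hdlt : ∀ u, u < s → deriv θ u = 0 := fun u hu => by
    have : θ =ᶠ[𝓝 u] fun _ => 0 := Filter.eventually_of_mem (Iio_mem_nhds hu) fun v hv => hθ0 v hv.le
    rw [this.deriv_eq, deriv_const]
  have hdgt : ∀ u, s + w < u → deriv θ u = 0 := fun u hu => by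
    have : θ =ᶠ[𝓝 u] fun _ => 1 := Filter.eventually_of_mem (Ioi_mem_nhds hu) fun v hv => hθ1 v hv.le
    rw [this.deriv_eq, deriv_const]
  have ht : 0 < t := hs.trans hst
  have key := weighted_weakIdentity hf h hφ hθc ht.le
  rw [hθ0 0 hs.le, hθ1 t (by linarith), one_mul, zero_mul, sub_zero] at key
  have cd : Continuous (deriv θ) := hθc.continuous_deriv le_rfl
  have cF : ContinuousOn F (uIcc 0 t) := hcont.mono fun u hu => by
    rw [uIcc_of_le ht.le] at hu; exact hu.1
  have hint : (∫ u in (0 : ℝ)..t, deriv θ u) = 1 := by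
    rw [intervalIntegral.integral_deriv_eq_sub
      (fun u _ => hθc.differentiable one_ne_zero u) (cd.intervalIntegrable _ _),
      hθ0 0 hs.le, hθ1 t (by linarith), sub_zero]
  have b1 : |(∫ u in (0 : ℝ)..t, deriv θ u * F u) - F s| ≤ κ := by
    have j1 : IntervalIntegrable (fun u => deriv θ u * F u) volume 0 t :=
      (cd.continuousOn.mul cF).intervalIntegrable
    have e : (∫ u in (0 : ℝ)..t, deriv θ u * F u) - F s
        = ∫ u in (0 : ℝ)..t, deriv θ u * (F u - F s) := by
      have j2 : IntervalIntegrable (fun u => deriv θ u * F s) volume 0 t :=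
        (cd.mul continuous_const).intervalIntegrable _ _
      simp_rw [mul_sub]
      rw [intervalIntegral.integral_sub j1 j2,
        intervalIntegral.integral_mul_const, hint, one_mul]
    have e' : κ = ∫ u in (0 : ℝ)..t, deriv θ u * κ := by
      rw [intervalIntegral.integral_mul_const, hint, one_mul]
    have j3 : IntervalIntegrable (fun u => deriv θ u * κ) volume 0 t :=
      (cd.mul continuous_const).intervalIntegrable _ _
    rw [e]
    refine le_of_le_of_eq (abs_intervalIntegral_le ht.le j3 fun u hu => ?_) e'.symm
    rw [abs_mul, abs_of_nonneg (hd0 u)]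
    rcases lt_or_ge u s with h1 | h1
    · simp [hdlt u h1]
    rcases lt_or_ge (s + w) u with h2 | h2
    · simp [hdgt u h2]
    refine mul_le_mul_of_nonneg_left ?_ (hd0 u)
    have := hclose (mem_Ici.2 (hs.le.trans h1)) (by rw [Real.dist_eq, abs_lt]; constructor <;> linarith)
    rw [Real.dist_eq] at this
    exact this.le
  have bound : ∀ (g : ℝ → ℝ) (M : ℝ), (∀ u ∈ Icc s t, |g u| ≤ M) →
      |∫ u in (0 : ℝ)..t, θ u * g u| ≤ M * (t - s) := by
    intro g M hg
    have j : IntervalIntegrable ((Ioc s t).indicator fun _ => M) volume 0 t :=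
      (intervalIntegrable_iff.2 ((integrableOn_const (by simp)).indicator measurableSet_Ioc))
    have hI : (∫ u in (0 : ℝ)..t, (Ioc s t).indicator (fun _ => M) u) = M * (t - s) := by
      rw [intervalIntegral.integral_of_le ht.le, setIntegral_indicator measurableSet_Ioc,
        inter_eq_right.2 (Ioc_subset_Ioc_left hs.le), setIntegral_const, smul_eq_mul,
        Real.volume_real_Ioc_of_le hst.le, mul_comm]
    rw [← hI]
    refine abs_intervalIntegral_le ht.le j fun u hu => ?_
    rw [abs_mul]
    by_cases hu' : u ∈ Ioc s t
    · rw [indicator_of_mem hu', abs_of_nonneg (smoothTransition.nonneg _)]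
      exact (mul_le_of_le_one_left (abs_nonneg _) (smoothTransition.le_one _)).trans
        (hg u (Ioc_subset_Icc_self hu'))
    · rw [indicator_of_notMem hu', hθ0 u (not_lt.1 fun h' => hu' ⟨h', hu.2⟩)]
      simp
  have b2 := bound _ Q hQ
  have b3 := bound _ P hP
  rw [intervalIntegral.integral_const_mul] at key
  have e3 : (∫ u in (0 : ℝ)..t, θ u * (c * ∫ η, fusionIntegrand r φ η ∂(f u)))
      = c * ∫ u in (0 : ℝ)..t, θ u * ∫ η, fusionIntegrand r φ η ∂(f u) := by
    rw [← intervalIntegral.integral_const_mul]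
    congr 1; ext u; ring
  rw [e3] at b3
  have hQts : 0 ≤ Q * (t - s) := mul_nonneg hQ0 (by linarith)
  rw [abs_le] at b1 b2 b3 ⊢
  constructor <;> linarith [b1.1, b1.2, b2.1, b2.2, b3.1, b3.2]

end Dynamics

theorem IsC0Quad.exists_contDiff_approx {φ : ℝ × ℝ → ℝ} (hφ : IsC0Quad φ) {δ : ℝ} (hδ : 0 < δ) :
    ∃ g : ℝ × ℝ → ℝ, ContDiff ℝ 1 g ∧ IsCcQuad g ∧ ∀ p, |φ p - g p| ≤ δ := by
  obtain ⟨hc, -, hd⟩ := hφ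
  obtain ⟨S, hS, hSQ, hsm⟩ := hd (δ / 2) (half_pos hδ)
  set w : ℝ × ℝ → ℝ := fun p => max (φ p - δ / 2) 0 - max (-φ p - δ / 2) 0 with hw
  have hwc : Continuous w := ((hc.sub continuous_const).max continuous_const).sub
    ((hc.neg.sub continuous_const).max continuous_const)
  have hw0 : ∀ p ∉ S, w p = 0 := fun p hp => by
    have := abs_le.1 (hsm p hp)
    simp only [hw]
    rw [max_eq_right (by linarith), max_eq_right (by linarith), sub_zero]
  have hwφ : ∀ p, |φ p - w p| ≤ δ / 2 := fun p => by
    simp only [hw]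
    rcases max_cases (φ p - δ / 2) 0 with h | h <;> rcases max_cases (-φ p - δ / 2) 0 with h' | h' <;>
      rw [h.1, h'.1, abs_le] <;> constructor <;> linarith [h.2, h'.2]
  obtain ⟨g, hg, hgw, hgs⟩ := hwc.exists_contDiff_approx 1 (ε := fun _ => δ / 2)
    continuous_const fun _ => half_pos hδ
  refine ⟨g, hg, hasCompactSupport_of_eq_zero hS hSQ hg.continuous fun p hp =>
    Function.notMem_support.1 fun h => hgs h (hw0 p hp), fun p => ?_⟩
  have h1 := hwφ p
  have h2 := (hgw p).le
  rw [dist_comm, Real.dist_eq] at h2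
  calc |φ p - g p| ≤ |φ p - w p| + |w p - g p| := abs_sub_le _ _ _
    _ ≤ δ := by linarith

/-- The fusion integrand of a test function is controlled by the isoperimetric excess, on a bounded
set staying away from zero volume. -/
theorem exists_abs_fusionIntegrand_le {r φ : ℝ × ℝ → ℝ} (hr : ContinuousOn r Quad)
    (h : ContDiff ℝ 1 φ) (hφ : IsCcQuad φ) :
    ∃ v₀ v₁ A₀ M : ℝ, 0 < v₀ ∧ v₀ ≤ v₁ ∧ 0 ≤ M ∧ ∀ η ∈ IsoRegion,
      fusionIntegrand r φ η = 0 ∨ (η.2 ∈ Icc v₀ v₁ ∧ η.1 ≤ A₀ ∧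
        |fusionIntegrand r φ η| ≤ M * ((η.1 - c0 * η.2 ^ ((2 : ℝ) / 3)) / η.1)) := by
  obtain ⟨-, hs, ht⟩ := hφ
  rcases (tsupport φ).eq_empty_or_nonempty with he | hne
  · refine ⟨1, 1, 0, 0, one_pos, le_rfl, le_rfl, fun η _ => Or.inl ?_⟩
    simp [fusionIntegrand, da_eq_zero_of_notMem_tsupport h (he ▸ notMem_empty η)]
  obtain ⟨p₀, hp₀, hmin⟩ := hs.exists_isMinOn hne continuous_snd.continuousOn
  obtain ⟨p₁, hp₁, hmax⟩ := hs.exists_isMaxOn hne continuous_snd.continuousOn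
  obtain ⟨A₀, hA₀⟩ := hs.exists_bound_of_continuousOn
    (continuous_fst : Continuous (Prod.fst : ℝ × ℝ → ℝ)).continuousOn
  obtain ⟨M, hM⟩ := hs.exists_bound_of_continuousOn
    (((hr.mono ht).mul (continuous_da h).continuousOn).mul continuous_fst.continuousOn)
  refine ⟨p₀.2, p₁.2, A₀, M, (ht hp₀).2, hmin hp₁, (norm_nonneg _).trans (hM p₀ hp₀),
    fun η hη => ?_⟩
  by_cases hm : η ∈ tsupport φ
  · refine Or.inr ⟨⟨hmin hm, hmax hm⟩, (le_abs_self _).trans (hA₀ η hm), ?_⟩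
    have ha := (isoRegion_subset_quad hη).1
    have hx : 0 ≤ (η.1 - c0 * η.2 ^ ((2 : ℝ) / 3)) / η.1 := div_nonneg (sub_nonneg.2 hη.2) ha.le
    have he : fusionIntegrand r φ η =
        -(r η * da φ η * η.1) * ((η.1 - c0 * η.2 ^ ((2 : ℝ) / 3)) / η.1) := by
      rw [fusionIntegrand]
      field_simp
      ring
    rw [he, abs_mul, abs_neg, abs_of_nonneg hx]
    exact mul_le_mul_of_nonneg_right (hM η hm) hx
  · exact Or.inl (by simp [fusionIntegrand, da_eq_zero_of_notMem_tsupport h hm])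

section Weight

variable {W : ℝ × ℝ → ℝ} {K : ℝ × ℝ → ℝ × ℝ → ℝ} {K₀ K₁ al be : ℝ}
  {r : ℝ × ℝ → ℝ} {R₀ R₁ mu sg B C T sb : ℝ}

/-- For positive times the fusion rate of change of an observable is bounded uniformly in the
fusion coefficient. -/
theorem exists_abs_fusion_rate_le (hK : IsCoagKernel K K₀ K₁ al be)
    (hr : IsFusionKernel r R₀ R₁ mu sg B) (hmu : 0 < mu) (hsb : 0 < sb)
    (hW : ∀ η ∈ IsoRegion, 1 ≤ W η) (hWal : ∀ η ∈ IsoRegion, η.2 ^ (-al) ≤ W η)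
    (hWbe : ∀ η ∈ IsoRegion, η.2 ^ be ≤ W η) (hWmu : ∀ η ∈ IsoRegion, η.1 ^ (mu + 3) ≤ W η)
    {φ : ℝ × ℝ → ℝ} (h : ContDiff ℝ 1 φ) (hφ : IsCcQuad φ) :
    ∃ P : ℝ, ∀ ε ∈ Ioo (0 : ℝ) 1, ∀ (fin : Measure (ℝ × ℝ)) (f : ℝ → Measure (ℝ × ℝ)),
      IsWeakSolution K r ε⁻¹ al be fin f →
      (∀ t ∈ Icc (0 : ℝ) T, HasMomentBound W C (f t)) →
      ∀ t ∈ Icc sb T, |ε⁻¹ * ∫ η, fusionIntegrand r φ η ∂(f t)| ≤ P := by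
  have hrc := hr.smooth.continuousOn
  obtain ⟨v₀, v₁, A₀, M, hv₀, hv₁, hM, hbd⟩ := exists_abs_fusionIntegrand_le hrc h hφ
  obtain ⟨c, k, D, hc, hk, hD, hbar⟩ := exists_fusion_barrier hr hmu hv₀ hv₁
  refine ⟨M / k * ((C / sb + D * C + 6 * K₀ * 1 * C ^ 2) / c), fun ε hε fin f hf hmom t ht => ?_⟩
  obtain ⟨-, hcont, -, hweak⟩ := hf
  obtain ⟨hε0, hε1⟩ := hε
  have ht0 : 0 < t := hsb.trans_le ht.1
  have htI : t ∈ Icc (0 : ℝ) T := ⟨ht0.le, ht.2⟩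
  have hC := (hmom t htI).nonneg hW
  have hεi : 1 ≤ ε⁻¹ := (one_le_inv₀ hε0).2 hε1.le
  set A : ℝ := |A₀| + ε⁻¹ with hA
  have hA1 : ε⁻¹ ≤ A := by linarith [abs_nonneg A₀]
  obtain ⟨Ψ, hΨ, hΨc, hΨ1, hdis, hlow⟩ := hbar A (hεi.trans hA1)
  have hΨabs : ∀ η ∈ IsoRegion, |Ψ η| ≤ 1 := fun η hη => by
    rw [abs_of_nonneg (hΨ1 η hη).1]; exact (hΨ1 η hη).2
  have hrelax := integral_le_of_dissipation hweak hcont hrc hW hmom hΨ hΨc hΨabs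
    (fun u hu => (hmom u hu).abs_coagTerm_le hW hK hWal hWbe hΨabs zero_le_one)
    (lam := ε⁻¹ * c) (D := D) (by positivity) hD (fun η hη => ?_) ht0 ht.2
  · have hpt : ∀ η ∈ IsoRegion, |fusionIntegrand r φ η| ≤ M / k * Ψ η := fun η hη => by
      rcases hbd η hη with h0 | ⟨hv, ha, hle⟩
      · rw [h0, abs_zero]
        exact mul_nonneg (div_nonneg hM hk.le) (hΨ1 η hη).1
      · have := hlow η hη hv (by linarith [le_abs_self A₀, inv_pos.2 hε0])
        calc _ ≤ _ := hle
          _ = M / k * (k * ((η.1 - c0 * η.2 ^ ((2 : ℝ) / 3)) / η.1)) := by field_simp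
          _ ≤ M / k * Ψ η := mul_le_mul_of_nonneg_left this (div_nonneg hM hk.le)
    have hint : |∫ η, fusionIntegrand r φ η ∂(f t)| ≤ M / k * ∫ η, Ψ η ∂(f t) := by
      rw [← integral_const_mul]
      exact norm_integral_le_of_norm_le (f := fusionIntegrand r φ)
        (((hmom t htI).integrable_of_isC0Quad hW hΨc.isC0Quad).const_mul _)
        ((hmom t htI).iso.mono hpt)
    have hK0 : 0 ≤ K₀ := (hK.K1_pos.trans_le hK.K1_le_K0).le
    have hCt : C / t ≤ C / sb := div_le_div_of_nonneg_left hC hsb ht.1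
    rw [abs_mul, abs_of_pos (inv_pos.2 hε0)]
    calc ε⁻¹ * |∫ η, fusionIntegrand r φ η ∂(f t)|
        ≤ ε⁻¹ * (M / k * ((C / t + D * C + 6 * K₀ * 1 * C ^ 2) / (ε⁻¹ * c))) := by
          refine mul_le_mul_of_nonneg_left (hint.trans ?_) (inv_pos.2 hε0).le
          exact mul_le_mul_of_nonneg_left hrelax (div_nonneg hM hk.le)
      _ = M / k * ((C / t + D * C + 6 * K₀ * 1 * C ^ 2) / c) := by field_simp
      _ ≤ _ := by gcongr
  · have hA2 : ε⁻¹ * (D / A ^ 2) ≤ D := by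
      have hsq : ε⁻¹ ≤ A ^ 2 := by nlinarith
      have hApos : 0 < A ^ 2 := by positivity
      rw [← mul_div_assoc, div_le_iff₀ hApos, mul_comm]
      exact mul_le_mul_of_nonneg_left hsq hD
    have hpw := rpow_nonneg (isoRegion_subset_quad hη).1.le (mu + 3)
    calc ε⁻¹ * c * Ψ η + ε⁻¹ * fusionIntegrand r Ψ η
        = ε⁻¹ * (c * Ψ η + fusionIntegrand r Ψ η) := by ring
      _ ≤ ε⁻¹ * (D / A ^ 2 * η.1 ^ (mu + 3)) :=
          mul_le_mul_of_nonneg_left (hdis η hη) (inv_pos.2 hε0).le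
      _ = ε⁻¹ * (D / A ^ 2) * η.1 ^ (mu + 3) := by ring
      _ ≤ D * W η := mul_le_mul hA2 (hWmu η hη) hpw hD

/-- Test observables are Lipschitz in time, away from the initial time, uniformly in the fusion
coefficient. -/
theorem exists_lipschitz_integral (hK : IsCoagKernel K K₀ K₁ al be)
    (hr : IsFusionKernel r R₀ R₁ mu sg B) (hmu : 0 < mu) (hsb : 0 < sb)
    (hW : ∀ η ∈ IsoRegion, 1 ≤ W η) (hWal : ∀ η ∈ IsoRegion, η.2 ^ (-al) ≤ W η)
    (hWbe : ∀ η ∈ IsoRegion, η.2 ^ be ≤ W η) (hWmu : ∀ η ∈ IsoRegion, η.1 ^ (mu + 3) ≤ W η)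
    {φ : ℝ × ℝ → ℝ} (h : ContDiff ℝ 1 φ) (hφ : IsCcQuad φ) :
    ∃ L : ℝ, 0 ≤ L ∧ ∀ ε ∈ Ioo (0 : ℝ) 1, ∀ (fin : Measure (ℝ × ℝ))
      (f : ℝ → Measure (ℝ × ℝ)), IsWeakSolution K r ε⁻¹ al be fin f →
      (∀ t ∈ Icc (0 : ℝ) T, HasMomentBound W C (f t)) →
      ∀ s ∈ Icc sb T, ∀ t ∈ Icc sb T,
        |(∫ η, φ η ∂(f t)) - ∫ η, φ η ∂(f s)| ≤ L * |t - s| := by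
  obtain ⟨P, hP⟩ := exists_abs_fusion_rate_le (T := T) (C := C) hK hr hmu hsb hW hWal hWbe hWmu h hφ
  obtain ⟨b, hb⟩ := hφ.2.1.exists_bound_of_continuous hφ.1
  have hb0 : 0 ≤ b := (norm_nonneg _).trans (hb 0)
  refine ⟨max (6 * K₀ * b * C ^ 2 + P) 0, le_max_right _ _, fun ε hε fin f hf hmom => ?_⟩
  have key : ∀ s ∈ Icc sb T, ∀ t ∈ Icc sb T, s < t →
      |(∫ η, φ η ∂(f t)) - ∫ η, φ η ∂(f s)| ≤ max (6 * K₀ * b * C ^ 2 + P) 0 * |t - s| := by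
    intro s hs t ht hst
    have hsub : ∀ u ∈ Icc s t, u ∈ Icc sb T := fun u hu => ⟨hs.1.trans hu.1, hu.2.trans ht.2⟩
    refine (abs_integral_sub_le hf.2.2.2 h hφ (hf.2.1 φ hφ.isC0Quad) (hsb.trans_le hs.1) hst
      (fun u hu => (hmom u ⟨hsb.le.trans (hsub u hu).1, (hsub u hu).2⟩).abs_coagTerm_le hW hK
        hWal hWbe (fun η _ => hb η) hb0)
      (fun u hu => hP ε hε fin f hf hmom u (hsub u hu))).trans ?_
    rw [abs_of_pos (sub_pos.2 hst)]
    exact mul_le_mul_of_nonneg_right (le_max_left _ _) (sub_pos.2 hst).le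
  intro s hs t ht
  rcases lt_trichotomy s t with hst | rfl | hst
  · exact key s hs t ht hst
  · simp
  · rw [abs_sub_comm, abs_sub_comm t]
    exact key t ht s hs hst

end Weight

theorem hasMomentBound_of_lintegral_le {ν : Measure (ℝ × ℝ)} (hν : IsIsoMeasure ν)
    {W : ℝ × ℝ → ℝ} (hWm : Measurable W) (hW : ∀ η ∈ IsoRegion, 0 ≤ W η) {C : ℝ≥0∞} (hC : C ≠ ⊤)
    (h : ∫⁻ η, ENNReal.ofReal (W η) ∂ν ≤ C) : HasMomentBound W C.toReal ν := by
  have hiso : ∀ᵐ η ∂ν, η ∈ IsoRegion := hν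
  have h0 : 0 ≤ᵐ[ν] W := hiso.mono hW
  refine ⟨hiso, ⟨hWm.aestronglyMeasurable, ?_⟩, ?_⟩
  · rw [hasFiniteIntegral_iff_ofReal h0]
    exact h.trans_lt hC.lt_top
  · rw [integral_eq_lintegral_of_nonneg_ae h0 hWm.aestronglyMeasurable]
    exact ENNReal.toReal_mono hC h

/-- equicontinuity in time, for positive times, of the family of fast-fusion
solutions, uniformly for all sufficiently small ε. -/
theorem equicontinuity_positive_times
    (K : ℝ × ℝ → ℝ × ℝ → ℝ) (K₀ K₁ al be : ℝ) (hK : IsCoagKernel K K₀ K₁ al be)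
    (r : ℝ × ℝ → ℝ) (R₀ R₁ mu sg B : ℝ) (hr : IsFusionKernel r R₀ R₁ mu sg B)
    (hmu : 0 < mu)
    (T sb : ℝ) (hsb : 0 < sb) (hsbT : sb < T)
    (fin : Measure (ℝ × ℝ)) (hfin_iso : IsIsoMeasure fin)
    (f : ℝ → ℝ → Measure (ℝ × ℝ))
    (hsol : ∀ ε ∈ Ioo (0 : ℝ) 1, IsWeakSolution K r ε⁻¹ al be fin (f ε))
    (hmom : ∃ C : ℝ≥0∞, C ≠ ⊤ ∧ ∀ ε ∈ Ioo (0 : ℝ) 1, ∀ t ∈ Icc (0 : ℝ) T,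
        (∫⁻ η : ℝ × ℝ, ENNReal.ofReal
          (η.2 ^ (-1 : ℝ) + η.2 ^ (2 : ℝ) + η.1
            + η.1 ^ (mu + 3) + η.2 ^ (sg * (mu + 3))) ∂(f ε t)) ≤ C) :
    ∀ φ : ℝ × ℝ → ℝ, IsC0Quad φ → (∀ p, |φ p| ≤ 1) →
      ∀ eb ∈ Ioo (0 : ℝ) 1, ∃ db ∈ Ioo (0 : ℝ) sb, ∃ ε₀ ∈ Ioo (0 : ℝ) 1,
        ∀ ε ∈ Ioo (0 : ℝ) 1, ε ≤ ε₀ →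
          ∀ s ∈ Icc sb T, ∀ t ∈ Icc sb T, |t - s| ≤ db →
            |(∫ η, φ η ∂(f ε t)) - (∫ η, φ η ∂(f ε s))| ≤ eb := by
  intro φ hφ _ eb heb
  obtain ⟨C, hC, hmom⟩ := hmom
  set W : ℝ × ℝ → ℝ := fun η => η.2 ^ (-1 : ℝ) + η.2 ^ (2 : ℝ) + η.1
    + η.1 ^ (mu + 3) + η.2 ^ (sg * (mu + 3)) with hWdef
  have hWm : Measurable W := by fun_prop
  have hWmu : ∀ η ∈ IsoRegion, η.1 ^ (mu + 3) ≤ W η := fun η hη => by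
    have hq := isoRegion_subset_quad hη
    have := rpow_pos_of_pos hq.2 (-1)
    have := rpow_pos_of_pos hq.2 2
    have := rpow_pos_of_pos hq.2 (sg * (mu + 3))
    simp only [hWdef]
    linarith [hq.1]
  have hWv : ∀ p : ℝ, -1 ≤ p → p ≤ 2 → ∀ η ∈ IsoRegion, η.2 ^ p ≤ W η := fun p h1 h2 η hη => by
    have hq := isoRegion_subset_quad hη
    have := rpow_le_rpow_neg_one_add_sq hq.2 h1 h2
    have := rpow_pos_of_pos hq.1 (mu + 3)
    have := rpow_pos_of_pos hq.2 (sg * (mu + 3))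
    simp only [hWdef]
    linarith [hq.1]
  have hW1 : ∀ η ∈ IsoRegion, 1 ≤ W η := fun η hη => by
    simpa using hWv 0 (by norm_num) (by norm_num) η hη
  have hbe := hK.be_mem
  have hba := hK.be_sub_al_mem
  have hal := hK.al_pos
  have hWal := hWv (-al) (by linarith [hbe.2, hba.1]) (by linarith)
  have hWbe := hWv be (by linarith [hbe.1]) (by linarith [hbe.2])
  have hM : ∀ ε ∈ Ioo (0 : ℝ) 1, ∀ t ∈ Icc (0 : ℝ) T, HasMomentBound W C.toReal (f ε t) :=
    fun ε hε t ht => hasMomentBound_of_lintegral_le ((hsol ε hε).1 t ht.1) hWm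
      (fun η hη => zero_le_one.trans (hW1 η hη)) hC (hmom ε hε t ht)
  have hC0 : 0 ≤ C.toReal := ENNReal.toReal_nonneg
  set δ : ℝ := eb / (4 * (C.toReal + 1)) with hδ
  have hδ0 : 0 < δ := div_pos heb.1 (by positivity)
  have hδC : δ * C.toReal ≤ eb / 4 := by
    rw [hδ, div_mul_eq_mul_div, div_le_div_iff₀ (by positivity) (by norm_num)]
    nlinarith [heb.1]
  obtain ⟨g, hg, hgc, hgφ⟩ := hφ.exists_contDiff_approx hδ0
  obtain ⟨L, hL, hlip⟩ := exists_lipschitz_integral (T := T) (C := C.toReal) hK hr hmu hsb hW1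
    hWal hWbe hWmu hg hgc
  have hdb : 0 < eb / (2 * (L + 1)) := div_pos heb.1 (by positivity)
  refine ⟨min (sb / 2) (eb / (2 * (L + 1))), ⟨lt_min (half_pos hsb) hdb,
    (min_le_left _ _).trans_lt (half_lt_self hsb)⟩, 1 / 2, by norm_num,
    fun ε hε _ s hs t ht hts => ?_⟩
  have happ : ∀ u ∈ Icc sb T, |(∫ η, φ η ∂(f ε u)) - ∫ η, g η ∂(f ε u)| ≤ eb / 4 := by
    intro u hu
    have hb := hM ε hε u ⟨hsb.le.trans hu.1, hu.2⟩
    rw [← integral_sub (hb.integrable_of_isC0Quad hW1 hφ)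
      (hb.integrable_of_isC0Quad hW1 hgc.isC0Quad)]
    refine (hb.abs_integral_le hδ0.le fun η hη => ?_).trans hδC
    exact (hgφ η).trans (le_mul_of_one_le_right hδ0.le (hW1 η hη))
  have h1 := abs_le.1 (happ t ht)
  have h2 := abs_le.1 (happ s hs)
  have h3 : L * |t - s| ≤ eb / 2 := by
    calc L * |t - s| ≤ (L + 1) * (eb / (2 * (L + 1))) :=
          mul_le_mul (by linarith) (hts.trans (min_le_right _ _)) (abs_nonneg _) (by linarith)
      _ = eb / 2 := by field_simp
  have h4 := abs_le.1 ((hlip ε hε fin (f ε) (hsol ε hε) (hM ε hε) s hs t ht).trans h3)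
  rw [abs_le]
  constructor <;> linarith [h1.1, h1.2, h2.1, h2.2, h4.1, h4.2]
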